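/- Let X be a Banach space continuously embedded in a Banach space Y, and let X_n ⊂ X, n = 1,2,…, be finite-dimensional subspaces with dimensions D_n satisfying D_n ≍ 2^n n^c for some c ≥ 0. Let a, b ∈ ℝ, and suppose there exist α ∈ ℝ, γ ≥ 0 and β ∈ (0,1] such that the unit balls B(X_n) := {f ∈ X_n : ‖f‖_X ≤ 1} satisfy ε_k(B(X_n), Y) ≤ C₀ · n^α · (D_n/(k+1))^β (log(4D_n/(k+1)))^γ for k ≤ 2D_n, and ε_k(B(X_n), Y) ≤ C₀ · n^α · 2^{−k/(2D_n)} for k ≥ 2D_n, with C₀ independent of n and k. If a > β, then ε_k(\bar W^{a,b}_X{X_n}, Y) ≪ k^{−a} (log k)^{ac+b+α}, i.e., there is a constant C > 0 such that ε_k(\bar W^{a,b}_X{X_n}, Y) ≤ C·k^{−a}(log k)^{ac+b+α} for all k ≥ 2. -/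

import Mathlib

open Filter

noncomputable section

/-- The entropy number `ε_k(A, Y)` of a subset `A` of a normed space `Y`. -/
noncomputable def entropy (Y : Type*) [NormedAddCommGroup Y] (k : ℕ) (A : Set Y) : ℝ :=
  sInf {ε : ℝ | 0 < ε ∧ ∃ y : Fin (2 ^ k) → Y, ∀ f ∈ A, ∃ j, ‖f - y j‖ ≤ ε}

/-- The class `\bar W^{a,b}_X{X_n}`: elements `f = ∑_{n≥1} f_n`, `f_n ∈ X_n`,
`‖f_n‖_X ≤ 2^{-an} n^b`. -/
def barWX {X : Type*} [NormedAddCommGroup X] [Module ℝ X]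
    (Xn : ℕ → Submodule ℝ X) (a b : ℝ) : Set X :=
  {f | ∃ g : ℕ → X, g 0 = 0 ∧
    (∀ n : ℕ, 1 ≤ n → g n ∈ Xn n ∧ ‖g n‖ ≤ 2 ^ (-(a * n)) * (n : ℝ) ^ b) ∧
    HasSum g f}

/-- `A` is covered by at most `2 ^ k` closed balls of radius `ε`. -/
def CoveredBy {Y : Type*} [NormedAddCommGroup Y] (k : ℕ) (ε : ℝ) (A : Set Y) : Prop :=
  ∃ T : Finset Y, T.card ≤ 2 ^ k ∧ ∀ f ∈ A, ∃ y ∈ T, ‖f - y‖ ≤ ε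

section Covering

variable {Y : Type*} [NormedAddCommGroup Y]

theorem CoveredBy.mono {k l : ℕ} {ε δ : ℝ} {A B : Set Y} (h : CoveredBy k ε A)
    (hkl : k ≤ l) (hε : ε ≤ δ) (hAB : B ⊆ A) : CoveredBy l δ B := by
  obtain ⟨T, hT, hc⟩ := h
  refine ⟨T, hT.trans (Nat.pow_le_pow_right two_pos hkl), fun f hf => ?_⟩
  obtain ⟨y, hy, hfy⟩ := hc f (hAB hf)
  exact ⟨y, hy, hfy.trans hε⟩

theorem entropy_le_of_coveredBy {k : ℕ} {ε : ℝ} {A : Set Y} (hε : 0 < ε)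
    (h : CoveredBy k ε A) : entropy Y k A ≤ ε := by
  obtain ⟨T, hT, hc⟩ := h
  refine csInf_le ⟨0, fun x hx => hx.1.le⟩ ⟨hε, ?_⟩
  refine ⟨fun j => if h : (j : ℕ) < T.card then (T.equivFin.symm ⟨j, h⟩ : Y) else 0,
    fun f hf => ?_⟩
  obtain ⟨y, hy, hfy⟩ := hc f hf
  refine ⟨⟨T.equivFin ⟨y, hy⟩, (T.equivFin ⟨y, hy⟩).2.trans_le hT⟩, ?_⟩
  simpa using hfy

theorem coveredBy_of_entropy_lt {k : ℕ} {ε R : ℝ} {A : Set Y} (hA : ∀ f ∈ A, ‖f‖ ≤ R)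
    (h : entropy Y k A < ε) : CoveredBy k ε A := by
  classical
  have hne : {δ : ℝ | 0 < δ ∧ ∃ y : Fin (2 ^ k) → Y, ∀ f ∈ A, ∃ j, ‖f - y j‖ ≤ δ}.Nonempty :=
    ⟨max R 1, lt_max_of_lt_right one_pos, fun _ => 0,
      fun f hf => ⟨0, by simpa using Or.inl (hA f hf)⟩⟩
  obtain ⟨δ, ⟨-, y, hy⟩, hδε⟩ := exists_lt_of_csInf_lt hne h
  refine ⟨Finset.univ.image y, Finset.card_image_le.trans (by simp), fun f hf => ?_⟩
  obtain ⟨j, hj⟩ := hy f hf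
  exact ⟨y j, Finset.mem_image_of_mem y (Finset.mem_univ j), hj.trans hδε.le⟩

theorem CoveredBy.sum {s : Finset ℕ} {k : ℕ → ℕ} {ε : ℕ → ℝ} {A : ℕ → Set Y}
    (h : ∀ n ∈ s, CoveredBy (k n) (ε n) (A n)) :
    CoveredBy (∑ n ∈ s, k n) (∑ n ∈ s, ε n)
      {f | ∃ g : ℕ → Y, (∀ n ∈ s, g n ∈ A n) ∧ f = ∑ n ∈ s, g n} := by
  classical
  induction s using Finset.induction_on with
  | empty =>
    refine ⟨{0}, by simp, ?_⟩
    rintro f ⟨g, -, rfl⟩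
    exact ⟨0, by simp⟩
  | insert m s hm ih =>
    obtain ⟨T, hT, hcT⟩ := ih fun n hn => h n (Finset.mem_insert_of_mem hn)
    obtain ⟨U, hU, hcU⟩ := h m (Finset.mem_insert_self m s)
    refine ⟨Finset.image₂ (· + ·) U T, ?_, ?_⟩
    · rw [Finset.sum_insert hm, pow_add]
      exact Finset.card_image₂_le _ _ _ |>.trans (Nat.mul_le_mul hU hT)
    · rintro f ⟨g, hg, rfl⟩
      obtain ⟨u, hu, hfu⟩ := hcU (g m) (hg m (Finset.mem_insert_self m s))
      obtain ⟨t, ht, hft⟩ := hcT (∑ n ∈ s, g n)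
        ⟨g, fun n hn => hg n (Finset.mem_insert_of_mem hn), rfl⟩
      refine ⟨u + t, Finset.mem_image₂_of_mem hu ht, ?_⟩
      rw [Finset.sum_insert hm, Finset.sum_insert hm, add_sub_add_comm]
      exact (norm_add_le _ _).trans (add_le_add hfu hft)

theorem CoveredBy.thicken {k : ℕ} {ε δ : ℝ} {A B : Set Y} (h : CoveredBy k ε A)
    (hB : ∀ f ∈ B, ∃ g ∈ A, ‖f - g‖ ≤ δ) : CoveredBy k (ε + δ) B := by
  obtain ⟨T, hT, hc⟩ := h
  refine ⟨T, hT, fun f hf => ?_⟩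
  obtain ⟨g, hg, hfg⟩ := hB f hf
  obtain ⟨y, hy, hgy⟩ := hc g hg
  refine ⟨y, hy, ?_⟩
  linarith [norm_sub_le_norm_sub_add_norm_sub f g y]

theorem CoveredBy.smul [NormedSpace ℝ Y] {k : ℕ} {ε t : ℝ} {A B : Set Y}
    (h : CoveredBy k ε A) (ht : 0 ≤ t) (hB : ∀ f ∈ B, ∃ g ∈ A, f = t • g) :
    CoveredBy k (t * ε) B := by
  classical
  obtain ⟨T, hT, hc⟩ := h
  refine ⟨T.image (t • ·), Finset.card_image_le.trans hT, fun f hf => ?_⟩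
  obtain ⟨g, hg, rfl⟩ := hB f hf
  obtain ⟨y, hy, hgy⟩ := hc g hg
  refine ⟨t • y, Finset.mem_image_of_mem _ hy, ?_⟩
  rw [← smul_sub, norm_smul, Real.norm_of_nonneg ht]
  gcongr

end Covering

/-- The exponentially decaying weight controlling the contribution of the levels at
distance `d` from the critical one. -/
def levelWeight (δ q : ℝ) (d : ℕ) : ℝ := 2 ^ (-(δ * d)) * (1 + d : ℝ) ^ q

theorem levelWeight_pos (δ q : ℝ) (d : ℕ) : 0 < levelWeight δ q d := by
  unfold levelWeight; positivity

theorem levelWeight_mono {δ e q r : ℝ} (hδ : δ ≤ e) (hr : r ≤ q) (d : ℕ) :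
    levelWeight e r d ≤ levelWeight δ q d := by
  unfold levelWeight
  have hd : (0 : ℝ) ≤ d := d.cast_nonneg
  gcongr
  · norm_num
  · linarith

theorem summable_levelWeight {δ : ℝ} (hδ : 0 < δ) (q : ℝ) :
    Summable (levelWeight δ q) := by
  obtain ⟨m, hm⟩ := exists_nat_ge q
  have hr : (2 : ℝ) ^ (-δ) < 1 := Real.rpow_lt_one_of_one_lt_of_neg one_lt_two (by linarith)
  have hr0 : 0 < (2 : ℝ) ^ (-δ) := by positivity
  have hs := summable_pow_mul_geometric_of_norm_lt_one (R := ℝ) m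
    (r := (2 : ℝ) ^ (-δ)) (by rwa [Real.norm_of_nonneg hr0.le])
  rw [← summable_nat_add_iff 1] at hs
  refine Summable.of_nonneg_of_le (fun d => (levelWeight_pos δ q d).le) (fun d => ?_)
    (hs.mul_left ((2 : ℝ) ^ δ))
  refine (levelWeight_mono le_rfl hm d).trans (le_of_eq ?_)
  unfold levelWeight
  rw [Real.rpow_natCast, ← Real.rpow_natCast (2 ^ (-δ)), ← Real.rpow_mul two_pos.le]
  push_cast
  rw [mul_left_comm, ← Real.rpow_add two_pos, add_comm (d : ℝ) 1, mul_comm]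
  congr 2
  ring

theorem sum_natDist_le {w : ℕ → ℝ} (hw : ∀ d, 0 ≤ w d) (hs : Summable w)
    (s : Finset ℕ) (N : ℕ) : ∑ n ∈ s, w (Nat.dist n N) ≤ 2 * ∑' d, w d := by
  rw [← Finset.sum_filter_add_sum_filter_not s (· ≤ N), two_mul]
  refine add_le_add ?_ ?_
  · rw [← Finset.sum_image (f := w) (g := fun n => Nat.dist n N)]
    · exact hs.sum_le_tsum _ fun d _ => hw d
    · intro x hx y hy hxy
      simp only [Finset.coe_filter, Set.mem_ofPred_eq, Nat.dist] at hx hy hxy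
      omega
  · rw [← Finset.sum_image (f := w) (g := fun n => Nat.dist n N)]
    · exact hs.sum_le_tsum _ fun d _ => hw d
    · intro x hx y hy hxy
      simp only [Finset.coe_filter, Set.mem_ofPred_eq, Nat.dist] at hx hy hxy
      omega

theorem rpow_le_rpow_mul_of_comparable {x y h : ℝ} (hx : 0 < x) (hy : 0 < y) (hh : 0 < h)
    (hxy : x ≤ y * h) (hyx : y ≤ x * h) (p : ℝ) : x ^ p ≤ y ^ p * h ^ |p| := by
  rcases le_total 0 p with hp | hp
  · rw [abs_of_nonneg hp, ← Real.mul_rpow hy.le hh.le]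
    exact Real.rpow_le_rpow hx.le hxy hp
  · rw [abs_of_nonpos hp, Real.rpow_neg hh.le, ← div_eq_mul_inv, le_div_iff₀ (by positivity),
      ← Real.mul_rpow hx.le hh.le]
    exact Real.rpow_le_rpow_of_nonpos hy hyx hp

theorem rpow_le_rpow_mul_dist {n N : ℕ} (hn : 1 ≤ n) (hN : 1 ≤ N) (p : ℝ) :
    (n : ℝ) ^ p ≤ (N : ℝ) ^ p * (1 + Nat.dist n N : ℝ) ^ |p| := by
  have h1 : n ≤ N * (1 + Nat.dist n N) := by
    unfold Nat.dist
    nlinarith [le_tsub_add (a := N) (b := n)]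
  have h2 : N ≤ n * (1 + Nat.dist n N) := by
    unfold Nat.dist
    nlinarith [le_tsub_add (a := n) (b := N)]
  exact rpow_le_rpow_mul_of_comparable (by exact_mod_cast hn) (by exact_mod_cast hN)
    (by positivity) (by exact_mod_cast h1) (by exact_mod_cast h2) p

section Levels

variable {D : ℕ → ℝ} {E : ℕ → ℕ → ℝ} {a c c₂ p α β γ δ C₀ : ℝ} {n N : ℕ}

theorem dim_le_levelWeight (hc : 0 ≤ c) (hc₂ : 0 < c₂) (hn : 1 ≤ n) (hN : 1 ≤ N)
    (hD : D n ≤ c₂ * 2 ^ n * (n : ℝ) ^ c) :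
    D n ≤ c₂ * (2 ^ N * (N : ℝ) ^ c) * (2 ^ ((n : ℝ) - N) * (1 + Nat.dist n N : ℝ) ^ c) := by
  have h := rpow_le_rpow_mul_dist hn hN c
  rw [abs_of_nonneg hc] at h
  have h2 : (2 : ℝ) ^ n = 2 ^ N * 2 ^ ((n : ℝ) - N) := by
    rw [← Real.rpow_natCast, ← Real.rpow_natCast, ← Real.rpow_add two_pos]; congr 1; ring
  calc D n ≤ c₂ * 2 ^ n * (n : ℝ) ^ c := hD
    _ ≤ c₂ * 2 ^ n * ((N : ℝ) ^ c * (1 + Nat.dist n N : ℝ) ^ c) := by gcongr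
    _ = _ := by rw [h2]; ring

/-- Bit allocation for a level at or below the critical one. -/
theorem exists_bits_of_le (ha : 0 < a) (hc : 0 ≤ c) (hc₂ : 0 < c₂) (hC₀ : 0 < C₀)
    (hn : 1 ≤ n) (hnN : n ≤ N) (hD1 : 1 ≤ D n) (hD : D n ≤ c₂ * 2 ^ n * (n : ℝ) ^ c)
    (hE : ∀ k : ℕ, 2 * D n ≤ k → E n k ≤ C₀ * (n : ℝ) ^ α * 2 ^ (-(k : ℝ) / (2 * D n)))
    (b : ℝ) :
    ∃ k : ℕ,
      (k : ℝ) ≤ 3 * (a + 1) * c₂ * (2 ^ N * (N : ℝ) ^ c) * levelWeight 1 (c + 1) (Nat.dist n N) ∧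
      2 ^ (-(a * n)) * (n : ℝ) ^ b * E n k ≤
        C₀ * (2 ^ (-(a * N)) * (N : ℝ) ^ (b + α)) * levelWeight 1 |b + α| (Nat.dist n N) := by
  have hN : 1 ≤ N := hn.trans hnN
  have hn0 : (0 : ℝ) < n := by exact_mod_cast hn
  have hd : ((Nat.dist n N : ℕ) : ℝ) = N - n := by
    rw [Nat.dist_eq_sub_of_le hnN, Nat.cast_sub hnN]
  have hd0 : (0 : ℝ) ≤ Nat.dist n N := Nat.cast_nonneg _
  have hnd : (n : ℝ) - N = -(1 * (Nat.dist n N : ℝ)) := by rw [hd]; ring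
  set d := Nat.dist n N with hdd
  have hle := Nat.le_ceil (2 * D n * (1 + (a + 1) * d))
  have hlt := Nat.ceil_lt_add_one (a := 2 * D n * (1 + (a + 1) * d)) (by positivity)
  set k := ⌈2 * D n * (1 + (a + 1) * d)⌉₊
  refine ⟨k, ?_, ?_⟩
  · have h1 := dim_le_levelWeight hc hc₂ hn hN hD
    rw [← hdd, hnd] at h1
    have h2 : (1 + d : ℝ) ^ (c + 1) = (1 + d) ^ c * (1 + d) := by
      rw [Real.rpow_add (by positivity), Real.rpow_one]
    have h3 : (k : ℝ) ≤ 3 * (a + 1) * (1 + d) * D n := by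
      have : 0 ≤ a * d := by positivity
      nlinarith [mul_nonneg (mul_nonneg (sub_nonneg.2 hD1) ha.le) hd0,
        mul_nonneg (sub_nonneg.2 hD1) ha.le, mul_nonneg (sub_nonneg.2 hD1) hd0]
    refine h3.trans ?_
    unfold levelWeight
    rw [h2]
    exact (mul_le_mul_of_nonneg_left h1 (by positivity)).trans_eq (by ring)
  · have hkD : 2 * D n ≤ k := by
      refine le_trans ?_ hle
      have : 0 ≤ (a + 1) * d := by positivity
      nlinarith
    have h1 : (2 : ℝ) ^ (-(k : ℝ) / (2 * D n)) ≤ 2 ^ (-((a + 1) * d)) := by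
      refine Real.rpow_le_rpow_of_exponent_le one_le_two ?_
      rw [div_le_iff₀ (by positivity)]
      nlinarith
    have h2 := rpow_le_rpow_mul_dist hn hN (b + α)
    calc 2 ^ (-(a * n)) * (n : ℝ) ^ b * E n k
        ≤ 2 ^ (-(a * n)) * (n : ℝ) ^ b * (C₀ * (n : ℝ) ^ α * 2 ^ (-((a + 1) * d))) := by
          gcongr; exact (hE k hkD).trans (by gcongr)
      _ = C₀ * (2 ^ (-(a * n)) * 2 ^ (-((a + 1) * d))) * (n : ℝ) ^ (b + α) := by
          rw [Real.rpow_add hn0]; ring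
      _ = C₀ * (2 ^ (-(a * N)) * 2 ^ (-(1 * (d : ℝ)))) * (n : ℝ) ^ (b + α) := by
          rw [← Real.rpow_add two_pos, ← Real.rpow_add two_pos, hd]; congr 3; ring
      _ ≤ C₀ * (2 ^ (-(a * N)) * 2 ^ (-(1 * (d : ℝ)))) *
            ((N : ℝ) ^ (b + α) * (1 + d) ^ |b + α|) := by gcongr
      _ = _ := by unfold levelWeight; ring

/-- Bit allocation for a level above the critical one. -/
theorem exists_bits_of_lt (hc : 0 ≤ c) (hc₂ : 0 < c₂) (hC₀ : 0 < C₀) (hγ : 0 ≤ γ)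
    (hβ0 : 0 < β) (hδ : 0 < δ) (hδ1 : δ ≤ 1)
    (hN : 1 ≤ N) (hnN : N < n) (hD1 : 1 ≤ D n) (hD : D n ≤ c₂ * 2 ^ n * (n : ℝ) ^ c)
    (hE : ∀ k : ℕ, (k : ℝ) ≤ 2 * D n → E n k ≤
      C₀ * (n : ℝ) ^ α * (D n / (k + 1)) ^ β * Real.log (4 * D n / (k + 1)) ^ γ)
    (b : ℝ) :
    ∃ k : ℕ,
      (k : ℝ) ≤ c₂ * (2 ^ N * (N : ℝ) ^ c) * levelWeight δ c (Nat.dist n N) ∧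
      2 ^ (-(a * n)) * (n : ℝ) ^ b * E n k ≤
        C₀ * 2 ^ γ * (2 ^ (-(a * N)) * (N : ℝ) ^ (b + α)) *
          levelWeight (a - (1 + δ) * β) (|b + α| + γ) (Nat.dist n N) := by
  have hn : 1 ≤ n := hN.trans hnN.le
  have hn0 : (0 : ℝ) < n := by exact_mod_cast hn
  have hd : ((Nat.dist n N : ℕ) : ℝ) = n - N := by
    rw [Nat.dist_eq_sub_of_le_right hnN.le, Nat.cast_sub hnN.le]
  have hd0 : (0 : ℝ) ≤ Nat.dist n N := Nat.cast_nonneg _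
  set d := Nat.dist n N with hdd
  have hle := Nat.floor_le (a := D n * 2 ^ (-((1 + δ) * d))) (by positivity)
  have hlt := Nat.lt_floor_add_one (D n * (2 : ℝ) ^ (-((1 + δ) * d)))
  set k := ⌊D n * (2 : ℝ) ^ (-((1 + δ) * d))⌋₊
  refine ⟨k, ?_, ?_⟩
  · have h1 := dim_le_levelWeight hc hc₂ hn hN hD
    rw [← hdd, ← hd] at h1
    refine hle.trans ?_
    unfold levelWeight
    calc D n * 2 ^ (-((1 + δ) * d)) ≤ _ := mul_le_mul_of_nonneg_right h1 (by positivity)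
      _ = c₂ * (2 ^ N * (N : ℝ) ^ c) * (2 ^ (d : ℝ) * 2 ^ (-((1 + δ) * d)) * (1 + d : ℝ) ^ c) := by
        ring
      _ = _ := by rw [← Real.rpow_add two_pos]; congr 4; ring
  · have hone : (2 : ℝ) ^ (-((1 + δ) * d)) ≤ 1 :=
      Real.rpow_le_one_of_one_le_of_nonpos one_le_two (by
        have : 0 ≤ (1 + δ) * d := by positivity
        linarith)
    have hkD : (k : ℝ) ≤ D n := hle.trans (mul_le_of_le_one_right (by linarith) hone)
    have hratio : D n / (k + 1) ≤ 2 ^ ((1 + δ) * d) := by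
      rw [div_le_iff₀ (by positivity)]
      rw [Real.rpow_neg two_pos.le, ← div_eq_mul_inv, div_lt_iff₀ (by positivity)] at hlt
      linarith
    have hlog : Real.log (4 * D n / (k + 1)) ≤ 2 * (1 + d) := by
      have h4 : 4 * D n / (k + 1) ≤ (2 : ℝ) ^ (2 * (1 + d : ℝ)) := by
        calc 4 * D n / (k + 1) = 2 ^ (2 : ℝ) * (D n / (k + 1)) := by norm_num; ring
          _ ≤ 2 ^ (2 : ℝ) * 2 ^ ((1 + δ) * d) := by gcongr
          _ = 2 ^ (2 + (1 + δ) * d) := by rw [Real.rpow_add two_pos]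
          _ ≤ _ := Real.rpow_le_rpow_of_exponent_le one_le_two (by nlinarith)
      calc Real.log (4 * D n / (k + 1)) ≤ Real.log (2 ^ (2 * (1 + d : ℝ))) :=
            Real.log_le_log (by positivity) h4
        _ = 2 * (1 + d) * Real.log 2 := Real.log_rpow two_pos _
        _ ≤ 2 * (1 + d) * 1 := by gcongr; linarith [Real.log_two_lt_d9]
        _ = _ := mul_one _
    have hlog0 : 0 ≤ Real.log (4 * D n / (k + 1)) := by
      refine Real.log_nonneg ?_
      rw [le_div_iff₀ (by positivity)]
      linarith
    have h2 := rpow_le_rpow_mul_dist hn hN (b + α)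
    have hEk : E n k ≤ C₀ * (n : ℝ) ^ α * (2 ^ ((1 + δ) * d)) ^ β * (2 * (1 + d)) ^ γ :=
      (hE k (by linarith)).trans (by gcongr)
    calc 2 ^ (-(a * n)) * (n : ℝ) ^ b * E n k
        ≤ 2 ^ (-(a * n)) * (n : ℝ) ^ b *
            (C₀ * (n : ℝ) ^ α * (2 ^ ((1 + δ) * d)) ^ β * (2 * (1 + d)) ^ γ) := by gcongr
      _ = C₀ * 2 ^ γ * (2 ^ (-(a * n)) * 2 ^ ((1 + δ) * d * β)) * (n : ℝ) ^ (b + α) *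
            (1 + d) ^ γ := by
          rw [Real.rpow_add hn0, Real.mul_rpow two_pos.le (by positivity),
            ← Real.rpow_mul two_pos.le]
          ring
      _ = C₀ * 2 ^ γ * (2 ^ (-(a * N)) * 2 ^ (-((a - (1 + δ) * β) * d))) * (n : ℝ) ^ (b + α) *
            (1 + d) ^ γ := by
          rw [← Real.rpow_add two_pos, ← Real.rpow_add two_pos, hd]; congr 4; ring
      _ ≤ C₀ * 2 ^ γ * (2 ^ (-(a * N)) * 2 ^ (-((a - (1 + δ) * β) * d))) *
            ((N : ℝ) ^ (b + α) * (1 + d) ^ |b + α|) * (1 + d) ^ γ := by gcongr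
      _ = _ := by
          unfold levelWeight
          rw [Real.rpow_add (x := (1 + d : ℝ)) (by positivity)]
          ring

/-- Bit allocation over all levels, with geometrically decaying cost and error away from
the critical level `N`. -/
theorem exists_bits (hc : 0 ≤ c) (hc₂ : 0 < c₂) (hγ : 0 ≤ γ) (hβ0 : 0 < β) (hβ1 : β ≤ 1)
    (hC₀ : 0 < C₀) (hab : β < a)
    (hD : ∀ n : ℕ, 1 ≤ n → 1 ≤ D n ∧ D n ≤ c₂ * 2 ^ n * (n : ℝ) ^ c)
    (hE : ∀ n : ℕ, 1 ≤ n → ∀ k : ℕ,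
      ((k : ℝ) ≤ 2 * D n → E n k ≤
        C₀ * (n : ℝ) ^ α * (D n / (k + 1)) ^ β * Real.log (4 * D n / (k + 1)) ^ γ) ∧
      (2 * D n ≤ k → E n k ≤ C₀ * (n : ℝ) ^ α * 2 ^ (-(k : ℝ) / (2 * D n)))) (b : ℝ) :
    ∃ (A B : ℝ) (w : ℕ → ℝ), 0 < A ∧ 0 < B ∧ (∀ d, 0 < w d) ∧ Summable w ∧
      ∀ N : ℕ, 1 ≤ N → ∀ n : ℕ, 1 ≤ n → ∃ k : ℕ,
        (k : ℝ) ≤ A * (2 ^ N * (N : ℝ) ^ c) * w (Nat.dist n N) ∧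
        2 ^ (-(a * n)) * (n : ℝ) ^ b * E n k ≤
          B * (2 ^ (-(a * N)) * (N : ℝ) ^ (b + α)) * w (Nat.dist n N) := by
  have ha : 0 < a := hβ0.trans hab
  set δ := min 1 ((a - β) / 2)
  have hδ : 0 < δ := lt_min one_pos (by linarith)
  have hδ1 : δ ≤ 1 := min_le_left _ _
  have hδa : δ ≤ (a - β) / 2 := min_le_right _ _
  have hδ2 : δ ≤ a - (1 + δ) * β := by nlinarith
  set q := c + 1 + |b + α| + γ
  have habs := abs_nonneg (b + α)
  refine ⟨3 * (a + 1) * c₂, C₀ * 2 ^ γ, levelWeight δ q, by positivity, by positivity,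
    levelWeight_pos δ q, summable_levelWeight hδ q, fun N hN n hn => ?_⟩
  obtain ⟨hD1, hD2⟩ := hD n hn
  rcases le_or_gt n N with h | h
  · obtain ⟨k, hk, hEk⟩ := exists_bits_of_le (E := E) (α := α) ha hc hc₂ hC₀ hn h hD1 hD2
      (fun k => (hE n hn k).2) b
    refine ⟨k, hk.trans ?_, hEk.trans ?_⟩
    · gcongr
      exact levelWeight_mono hδ1 (by simp only [q]; linarith) _
    · gcongr
      · exact (levelWeight_pos _ _ _).le
      · exact le_mul_of_one_le_right hC₀.le (Real.one_le_rpow one_le_two hγ)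
      · exact levelWeight_mono hδ1 (by simp only [q]; linarith) _
  · obtain ⟨k, hk, hEk⟩ := exists_bits_of_lt (E := E) (α := α) (a := a) hc hc₂ hC₀ hγ hβ0 hδ hδ1
      hN h hD1 hD2 (fun k => (hE n hn k).1) b
    refine ⟨k, hk.trans ?_, hEk.trans ?_⟩
    · gcongr
      · exact (levelWeight_pos _ _ _).le
      · nlinarith
      · exact levelWeight_mono le_rfl (by simp only [q]; linarith) _
    · gcongr
      exact levelWeight_mono hδ2 (by simp only [q]; linarith) _

end Levels

/-- A budget lies between two consecutive multiples of `2 ^ N * N ^ c`. -/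
theorem exists_level {A c x : ℝ} (hA : 1 ≤ A) (hc : 0 ≤ c) (hx : 2 * A ≤ x) :
    ∃ N : ℕ, 1 ≤ N ∧ A * (2 ^ N * (N : ℝ) ^ c) ≤ x ∧
      x ≤ A * 2 ^ (1 + c) * (2 ^ N * (N : ℝ) ^ c) := by
  classical
  have hex : ∃ N : ℕ, x < A * (2 ^ (N + 1) * ((N + 1 : ℕ) : ℝ) ^ c) := by
    obtain ⟨n, hn⟩ := exists_nat_gt x
    refine ⟨n, hn.trans_le ?_⟩
    have h1 : (n : ℝ) ≤ 2 ^ (n + 1) := by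
      exact_mod_cast (Nat.lt_two_pow_self.le.trans (Nat.pow_le_pow_right two_pos n.le_succ))
    have h2 : (1 : ℝ) ≤ ((n + 1 : ℕ) : ℝ) ^ c :=
      Real.one_le_rpow (by exact_mod_cast Nat.succ_pos n) hc
    calc (n : ℝ) = 1 * (n * 1) := by ring
      _ ≤ _ := by gcongr
  have hlt := Nat.find_spec hex
  have hmin := fun m (hm : m < Nat.find hex) => not_lt.1 (Nat.find_min hex hm)
  generalize Nat.find hex = N at hlt hmin
  have hN : 1 ≤ N := by
    by_contra h
    obtain rfl : N = 0 := by omega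
    norm_num at hlt
    linarith
  have hN1 : (1 : ℝ) ≤ N := by exact_mod_cast hN
  refine ⟨N, hN, ?_, ?_⟩
  · simpa [Nat.sub_add_cancel hN] using hmin (N - 1) (by omega)
  · refine hlt.le.trans ?_
    calc A * (2 ^ (N + 1) * ((N + 1 : ℕ) : ℝ) ^ c) ≤ A * (2 ^ (N + 1) * (2 * N : ℝ) ^ c) := by
          gcongr; push_cast; linarith
      _ = _ := by
          rw [Real.mul_rpow two_pos.le (by positivity), Real.rpow_add two_pos, Real.rpow_one]
          ring

theorem exists_bound_of_level_bound {F : ℕ → ℝ} {A M a c p : ℝ} (hA : 1 ≤ A) (hM : 0 < M)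
    (ha : 0 < a) (hc : 0 ≤ c)
    (hF : ∀ N : ℕ, 1 ≤ N → ∀ k : ℕ, A * (2 ^ N * (N : ℝ) ^ c) ≤ k →
      F k ≤ M * (2 ^ (-(a * N)) * (N : ℝ) ^ p)) :
    ∃ C : ℝ, 0 < C ∧ ∀ k : ℕ, 2 ≤ k →
      F k ≤ C * (k : ℝ) ^ (-a) * Real.log k ^ (a * c + p) := by
  set q := a * c + p with hq
  set G := A * 2 ^ (1 + c) with hG
  have hG1 : 1 ≤ G := one_le_mul_of_one_le_of_one_le hA
    (Real.one_le_rpow one_le_two (by linarith))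
  have hlogG := Real.log_nonneg hG1
  set H := Real.log G + 2 + c
  have hH0 : 0 < H := by positivity
  set C₁ := M * G ^ a * H ^ |q|
  let r : ℕ → ℝ := fun k => (k : ℝ) ^ (-a) * Real.log k ^ q
  have hrpos : ∀ k : ℕ, 2 ≤ k → 0 < r k := fun k hk => by
    have hk' : (1 : ℝ) < k := by exact_mod_cast hk
    have := Real.log_pos hk'
    simp only [r]
    positivity
  have hlarge : ∀ k : ℕ, 2 * A ≤ k → F k ≤ C₁ * r k := by
    intro k hk
    obtain ⟨N, hN, hNk, hkN⟩ := exists_level hA hc hk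
    rw [← hG] at hkN
    have hN1 : (1 : ℝ) ≤ N := by exact_mod_cast hN
    have hN0 : (0 : ℝ) < N := by linarith
    have hk0 : (0 : ℝ) < k := by linarith
    have hNc : (1 : ℝ) ≤ (N : ℝ) ^ c := Real.one_le_rpow hN1 hc
    have h2k : (2 : ℝ) ^ N ≤ k := by
      refine le_trans ?_ hNk
      calc (2 : ℝ) ^ N = 1 * (2 ^ N * 1) := by ring
        _ ≤ _ := by gcongr
    have hlow : N * Real.log 2 ≤ Real.log k := by
      rw [← Real.log_pow]
      exact Real.log_le_log (by positivity) h2k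
    have hup : Real.log k ≤ Real.log G + (N * Real.log 2 + c * Real.log N) := by
      refine (Real.log_le_log hk0 hkN).trans_eq ?_
      rw [Real.log_mul (x := G) (by positivity) (by positivity),
        Real.log_mul (x := (2 : ℝ) ^ N) (by positivity) (by positivity), Real.log_pow, Real.log_rpow hN0]
    have hl2 := Real.log_two_gt_d9
    have hl2' := Real.log_two_lt_d9
    have hlogN : Real.log N ≤ N := (Real.log_le_sub_one_of_pos hN0).trans (by linarith)
    have hlogk : 0 < Real.log k := by nlinarith
    have hNq : (N : ℝ) ^ q ≤ Real.log k ^ q * H ^ |q| := by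
      refine rpow_le_rpow_mul_of_comparable hN0 hlogk hH0 ?_ ?_ q
      · have : 2 ≤ H := by linarith
        nlinarith
      · nlinarith [mul_le_mul_of_nonneg_left hlogN hc]
    have hLa : (2 : ℝ) ^ (-(a * N)) * (N : ℝ) ^ p =
        (2 ^ N * (N : ℝ) ^ c) ^ (-a) * (N : ℝ) ^ q := by
      rw [Real.mul_rpow (by positivity) (by positivity), ← Real.rpow_natCast,
        ← Real.rpow_mul two_pos.le, ← Real.rpow_mul hN0.le, mul_assoc, ← Real.rpow_add hN0, hq]
      congr 2 <;> ring
    have hka : (2 ^ N * (N : ℝ) ^ c) ^ (-a) ≤ G ^ a * (k : ℝ) ^ (-a) := by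
      have : (k : ℝ) / G ≤ 2 ^ N * (N : ℝ) ^ c := by
        rw [div_le_iff₀ (by positivity), mul_comm]; exact hkN
      refine (Real.rpow_le_rpow_of_nonpos (by positivity) this (by linarith)).trans_eq ?_
      rw [Real.div_rpow hk0.le (by positivity), Real.rpow_neg (by positivity : 0 ≤ G),
        div_inv_eq_mul, mul_comm]
    calc F k ≤ M * (2 ^ (-(a * N)) * (N : ℝ) ^ p) := hF N hN k hNk
      _ ≤ M * ((G ^ a * (k : ℝ) ^ (-a)) * (Real.log k ^ q * H ^ |q|)) := by
          rw [hLa]; gcongr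
      _ = C₁ * r k := by simp only [C₁, r]; ring
  have hC₁0 : 0 < C₁ := by positivity
  set K := ⌈2 * A⌉₊
  set T := ∑ k ∈ Finset.range K, |F k / r k|
  have hT : 0 ≤ T := Finset.sum_nonneg fun _ _ => abs_nonneg _
  refine ⟨C₁ + T, by linarith, fun k hk => ?_⟩
  have hrk := hrpos k hk
  rw [mul_assoc]
  change F k ≤ (C₁ + T) * r k
  by_cases hkK : k < K
  · have h1 : |F k / r k| ≤ T := Finset.single_le_sum (f := fun k => |F k / r k|)
      (fun _ _ => abs_nonneg _) (Finset.mem_range.2 hkK)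
    rw [← div_le_iff₀ hrk]
    linarith [le_abs_self (F k / r k)]
  · have := hlarge k (Nat.ceil_le.1 (not_lt.1 hkK))
    nlinarith

/-- Elements of the class are approximated uniformly by their partial sums. -/
theorem exists_partialSum_approx {X : Type*} [NormedAddCommGroup X] [Module ℝ X]
    (Xn : ℕ → Submodule ℝ X) {a : ℝ} (ha : 0 < a) (b : ℝ) {η : ℝ} (hη : 0 < η) :
    ∃ m : ℕ, ∀ f ∈ barWX Xn a b, ∃ g : ℕ → X,
      (∀ n, 1 ≤ n → g n ∈ Xn n ∧ ‖g n‖ ≤ 2 ^ (-(a * n)) * (n : ℝ) ^ b) ∧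
      ‖f - ∑ n ∈ Finset.Icc 1 m, g n‖ ≤ η := by
  have hs := summable_levelWeight ha |b|
  obtain ⟨m, hm⟩ := ((tendsto_order.1 (tendsto_sum_nat_add (levelWeight a |b|))).2 η hη
    |>.and (eventually_ge_atTop 1)).exists
  obtain ⟨hm, hm1⟩ := hm
  refine ⟨m - 1, ?_⟩
  rintro f ⟨g, hg0, hg, hsum⟩
  refine ⟨g, hg, ?_⟩
  have hgn : ∀ n, ‖g n‖ ≤ levelWeight a |b| n := by
    intro n
    rcases Nat.eq_zero_or_pos n with rfl | hn
    · rw [hg0, norm_zero]; exact (levelWeight_pos _ _ _).le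
    · have hn' : (1 : ℝ) ≤ n := by exact_mod_cast hn
      refine (hg n hn).2.trans ?_
      unfold levelWeight
      gcongr
      exact (Real.rpow_le_rpow_of_exponent_le hn' (le_abs_self b)).trans
        (by gcongr; linarith)
  have hpart : ∑ n ∈ Finset.Icc 1 (m - 1), g n = ∑ n ∈ Finset.range m, g n := by
    refine Finset.sum_subset (fun n hn => ?_) (fun n hn hn' => ?_)
    · simp only [Finset.mem_Icc, Finset.mem_range] at hn ⊢; omega
    · obtain rfl : n = 0 := by
        simp only [Finset.mem_Icc, Finset.mem_range] at hn hn'; omega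
      exact hg0
  rw [hpart, ← ((hasSum_nat_add_iff' m).2 hsum).tsum_eq]
  exact (tsum_of_norm_bounded ((summable_nat_add_iff m).2 hs).hasSum fun i => hgn (i + m)).trans
    hm.le

/-- Theorem 4.1 (Temlyakov): general scheme passing from entropy bounds for the unit
balls `B(X_n)` to entropy bounds for the class `\bar W^{a,b}_X{X_n}`. -/
theorem entropy_barWX_upper
    {X Y : Type*} [NormedAddCommGroup X] [NormedSpace ℝ X] [CompleteSpace X]
    [NormedAddCommGroup Y] [NormedSpace ℝ Y] [CompleteSpace Y]
    (ι : X →L[ℝ] Y) (hι : Function.Injective ι)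
    (Xn : ℕ → Submodule ℝ X) (hfd : ∀ n, FiniteDimensional ℝ (Xn n))
    (c : ℝ) (hc : 0 ≤ c)
    (hD : ∃ c₁ c₂ : ℝ, 0 < c₁ ∧ 0 < c₂ ∧ ∀ n : ℕ, 1 ≤ n →
      c₁ * 2 ^ n * (n : ℝ) ^ c ≤ (Module.finrank ℝ (Xn n) : ℝ) ∧
      (Module.finrank ℝ (Xn n) : ℝ) ≤ c₂ * 2 ^ n * (n : ℝ) ^ c)
    (a b α γ β C₀ : ℝ) (hγ : 0 ≤ γ) (hβ0 : 0 < β) (hβ1 : β ≤ 1) (hC₀ : 0 < C₀)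
    (hEA : ∀ n : ℕ, 1 ≤ n → ∀ k : ℕ,
      (((k : ℝ) ≤ 2 * (Module.finrank ℝ (Xn n) : ℝ)) →
        entropy Y k (ι '' {f : X | f ∈ Xn n ∧ ‖f‖ ≤ 1}) ≤
          C₀ * (n : ℝ) ^ α * ((Module.finrank ℝ (Xn n) : ℝ) / ((k : ℝ) + 1)) ^ β *
            Real.log (4 * (Module.finrank ℝ (Xn n) : ℝ) / ((k : ℝ) + 1)) ^ γ) ∧
      ((2 * (Module.finrank ℝ (Xn n) : ℝ) ≤ (k : ℝ)) →
        entropy Y k (ι '' {f : X | f ∈ Xn n ∧ ‖f‖ ≤ 1}) ≤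
          C₀ * (n : ℝ) ^ α * 2 ^ (-(k : ℝ) / (2 * (Module.finrank ℝ (Xn n) : ℝ)))))
    (hab : a > β) :
    ∃ C : ℝ, 0 < C ∧ ∀ k : ℕ, 2 ≤ k →
      entropy Y k (ι '' barWX Xn a b) ≤
        C * (k : ℝ) ^ (-a) * Real.log k ^ (a * c + b + α) := by
  obtain ⟨c₁, c₂, hc₁, hc₂, hD⟩ := hD
  have ha : 0 < a := hβ0.trans hab
  set S : ℕ → Set Y := fun n => ι '' {f : X | f ∈ Xn n ∧ ‖f‖ ≤ 1}
  have hSbdd : ∀ n, ∀ f ∈ S n, ‖f‖ ≤ ‖ι‖ := by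
    rintro n _ ⟨f, ⟨-, hf⟩, rfl⟩
    exact ι.le_of_opNorm_le_of_le le_rfl hf |>.trans_eq (mul_one _)
  obtain ⟨A, B, w, hA, hB, hw, hws, hbits⟩ := exists_bits
    (D := fun n => (Module.finrank ℝ (Xn n) : ℝ)) (E := fun n k => entropy Y k (S n))
    hc hc₂ hγ hβ0 hβ1 hC₀ hab
    (fun n hn => ⟨by
      have hn0 : (0 : ℝ) < n := by exact_mod_cast hn
      have h : (0 : ℝ) < Module.finrank ℝ (Xn n) := lt_of_lt_of_le (by positivity) (hD n hn).1
      exact_mod_cast h, (hD n hn).2⟩) hEA b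
  set W := ∑' d, w d
  have hW0 : 0 ≤ W := tsum_nonneg fun d => (hw d).le
  have key : ∀ N : ℕ, 1 ≤ N → ∀ k : ℕ, max 1 (A * (2 * W)) * (2 ^ N * (N : ℝ) ^ c) ≤ k →
      entropy Y k (ι '' barWX Xn a b) ≤
        (B * (4 * W + 1)) * (2 ^ (-(a * N)) * (N : ℝ) ^ (b + α)) := by
    intro N hN k hk
    have hN0 : (0 : ℝ) < N := by exact_mod_cast hN
    set L := 2 ^ N * (N : ℝ) ^ c
    have hL0 : 0 < L := by positivity
    set R := B * (2 ^ (-(a * N)) * (N : ℝ) ^ (b + α)) with hR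
    have hR0 : 0 < R := by positivity
    obtain ⟨m, hm⟩ := exists_partialSum_approx Xn ha b
      (η := R / (‖ι‖ + 1)) (by positivity)
    choose! l hl hlE using fun n hn => hbits N hN n hn
    set t : ℕ → ℝ := fun n => 2 ^ (-(a * n)) * (n : ℝ) ^ b
    set U : ℕ → Set Y := fun n => ι '' {f : X | f ∈ Xn n ∧ ‖f‖ ≤ t n}
    have hcov : ∀ n ∈ Finset.Icc 1 m,
        CoveredBy (l n) (2 * R * w (Nat.dist n N)) (U n) := by
      intro n hn
      have hn1 : 1 ≤ n := (Finset.mem_Icc.1 hn).1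
      have hn0 : (0 : ℝ) < n := by exact_mod_cast hn1
      have ht0 : 0 < t n := by simp only [t]; positivity
      have hwn := hw (Nat.dist n N)
      have hlt : entropy Y (l n) (S n) < 2 * R * w (Nat.dist n N) / t n := by
        rw [lt_div_iff₀ ht0, mul_comm]
        refine (hlE n hn1).trans_lt ?_
        linarith [mul_pos hR0 hwn]
      have h := (coveredBy_of_entropy_lt (hSbdd n) hlt).smul (B := U n) ht0.le ?_
      · rwa [mul_div_cancel₀ _ ht0.ne'] at h
      · rintro _ ⟨f, ⟨hf, hft⟩, rfl⟩
        refine ⟨ι ((t n)⁻¹ • f), ⟨_, ⟨(Xn n).smul_mem _ hf, ?_⟩, rfl⟩, ?_⟩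
        · rw [norm_smul, norm_inv, Real.norm_of_nonneg ht0.le, inv_mul_le_iff₀ ht0, mul_one]
          exact hft
        · rw [map_smul, smul_inv_smul₀ ht0.ne']
    have hwsum := sum_natDist_le (fun d => (hw d).le) hws (Finset.Icc 1 m) N
    have hbit : ∑ n ∈ Finset.Icc 1 m, l n ≤ k := by
      have : ((∑ n ∈ Finset.Icc 1 m, l n : ℕ) : ℝ) ≤ k := by
        push_cast
        calc ∑ n ∈ Finset.Icc 1 m, (l n : ℝ)
            ≤ ∑ n ∈ Finset.Icc 1 m, A * L * w (Nat.dist n N) :=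
              Finset.sum_le_sum fun n hn => hl n (Finset.mem_Icc.1 hn).1
          _ ≤ A * L * (2 * W) := by rw [← Finset.mul_sum]; gcongr
          _ = A * (2 * W) * L := by ring
          _ ≤ max 1 (A * (2 * W)) * L := by gcongr; exact le_max_right _ _
          _ ≤ k := hk
      exact_mod_cast this
    have hrad : ∑ n ∈ Finset.Icc 1 m, 2 * R * w (Nat.dist n N) ≤ 4 * W * R := by
      rw [← Finset.mul_sum]
      calc 2 * R * _ ≤ 2 * R * (2 * W) := mul_le_mul_of_nonneg_left hwsum (by positivity)
        _ = _ := by ring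
    have hfinal := ((CoveredBy.sum hcov).mono hbit hrad subset_rfl).thicken (δ := R)
      (B := ι '' barWX Xn a b) (by
        rintro _ ⟨f, hf, rfl⟩
        obtain ⟨g, hg, hfg⟩ := hm f hf
        refine ⟨∑ n ∈ Finset.Icc 1 m, ι (g n), ⟨fun n => ι (g n), fun n hn =>
          ⟨g n, hg n (Finset.mem_Icc.1 hn).1, rfl⟩, rfl⟩, ?_⟩
        rw [← map_sum, ← map_sub]
        calc _ ≤ ‖ι‖ * (R / (‖ι‖ + 1)) := ι.le_of_opNorm_le_of_le le_rfl hfg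
          _ ≤ (‖ι‖ + 1) * (R / (‖ι‖ + 1)) := by gcongr; linarith
          _ = R := mul_div_cancel₀ _ (by positivity))
    refine (entropy_le_of_coveredBy (by positivity) hfinal).trans_eq ?_
    rw [hR]
    ring
  rw [add_assoc]
  exact exists_bound_of_level_bound (F := fun k => entropy Y k (ι '' barWX Xn a b))
    (le_max_left _ _) (by positivity) ha hc key

end
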